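/- For every real number x, the series Σ_{l∈ℤ} 4x²/((2l−1)²π² + 4x²) converges and its sum equals x·tanh(x). -/

import Mathlib

lemma aux_coth (y : ℝ) (hy : y ≠ 0) :
    HasSum (fun n : ℤ => y ^ 2 / ((n : ℝ) ^ 2 * Real.pi ^ 2 + y ^ 2))
      (y * (Real.cosh y / Real.sinh y)) := by
  have hpi : (Real.pi : ℂ) ≠ 0 := by exact_mod_cast Real.pi_ne_zero
  have hyc : (y : ℂ) ≠ 0 := by exact_mod_cast hy
  have hs : Real.sinh y ≠ 0 := by simpa [Real.sinh_eq_zero] using hy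
  have hsc : Complex.sinh (y : ℂ) ≠ 0 := by
    rw [← Complex.ofReal_sinh]; exact_mod_cast hs
  set z : ℂ := (y : ℂ) * Complex.I / Real.pi with hzdef
  have hz : z ∈ Complex.integerComplement := by
    rw [Complex.mem_integerComplement_iff]
    rintro ⟨n, hn⟩
    have h1 : (n : ℂ) * Real.pi = y * Complex.I := by
      rw [hn, hzdef]; field_simp
    have := congrArg Complex.im h1
    simp at this
    exact hy this.symm
  have hz0 : z ≠ 0 := Complex.integerComplement.ne_zero hz
  have hS : HasSum (fun n : ℕ => cotTerm z n)
      (Real.pi * Complex.cot (Real.pi * z) - 1 / z) := by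
    rw [cot_series_rep' hz]
    exact (summable_cotTerm hz).hasSum
  have h2 := hS.mul_left (z / 2)
  have hterm : ∀ n : ℕ, z / 2 * cotTerm z n =
      ((y ^ 2 / (((n : ℝ) + 1) ^ 2 * Real.pi ^ 2 + y ^ 2) : ℝ) : ℂ) := by
    intro n
    have hne : (((n : ℝ) + 1) ^ 2 * Real.pi ^ 2 + y ^ 2 : ℝ) ≠ 0 := by positivity
    have hne' : (((n : ℂ) + 1) ^ 2 * (Real.pi : ℂ) ^ 2 + (y : ℂ) ^ 2) ≠ 0 := by exact_mod_cast hne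
    have hzz : z ^ 2 * (Real.pi : ℂ) ^ 2 = - (y : ℂ) ^ 2 := by
      rw [hzdef]; field_simp; simp
    rw [cotTerm_identity hz]
    have h3 : (z + ((n : ℂ) + 1)) * (z - ((n : ℂ) + 1)) ≠ 0 := by
      intro h
      apply hne'
      linear_combination (-(Real.pi : ℂ) ^ 2) * h + hzz
    push_cast
    rw [eq_div_iff hne']
    rw [show z / 2 * (2 * z * (1 / ((z + ((n : ℂ) + 1)) * (z - ((n : ℂ) + 1))))) =
      z ^ 2 / ((z + ((n : ℂ) + 1)) * (z - ((n : ℂ) + 1))) by ring]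
    rw [div_mul_eq_mul_div, div_eq_iff h3]
    linear_combination (((n : ℂ) + 1) ^ 2) * hzz
  have hval : z / 2 * (Real.pi * Complex.cot (Real.pi * z) - 1 / z) =
      (((y * (Real.cosh y / Real.sinh y) - 1) / 2 : ℝ) : ℂ) := by
    have h4 : (Real.pi : ℂ) * z = y * Complex.I := by rw [hzdef]; field_simp
    rw [h4, Complex.cot, Complex.cos_mul_I, Complex.sin_mul_I]
    push_cast
    rw [show z / 2 * (Real.pi * (Complex.cosh y / (Complex.sinh y * Complex.I)) - 1 / z) =
      ((Real.pi * z) * (Complex.cosh y / (Complex.sinh y * Complex.I)) - z / z) / 2 by ring, h4,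
      div_self hz0]
    have := Complex.I_ne_zero
    field_simp
  rw [hval] at h2
  simp_rw [hterm] at h2
  have h5 := Complex.hasSum_ofReal.mp h2
  have h6 := HasSum.of_add_one_of_neg_add_one
    (f := fun n : ℤ => y ^ 2 / ((n : ℝ) ^ 2 * Real.pi ^ 2 + y ^ 2))
    (m := (y * (Real.cosh y / Real.sinh y) - 1) / 2)
    (m' := (y * (Real.cosh y / Real.sinh y) - 1) / 2)
    (by simpa using h5) (by
      convert h5 using 3 with n
      push_cast; ring)
  convert h6 using 1
  simp [hy]
  ring

/-- For every real `x`, the series `Σ_{l ∈ ℤ} 4x²/((2l−1)²π² + 4x²)` converges with sum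
`x · tanh x`. -/
theorem stmt1 (x : ℝ) :
    HasSum (fun l : ℤ => 4 * x ^ 2 / ((2 * (l : ℝ) - 1) ^ 2 * Real.pi ^ 2 + 4 * x ^ 2))
      (x * Real.tanh x) := by
  by_cases hx : x = 0
  · subst hx; simp
  have hE := aux_coth x hx
  have hF := aux_coth (2 * x) (by simpa using hx)
  set F : ℤ → ℝ := fun n => (2 * x) ^ 2 / ((n : ℝ) ^ 2 * Real.pi ^ 2 + (2 * x) ^ 2) with hFdef
  have ie : Function.Injective (fun l : ℤ => 2 * l) := fun a b h => by
    simp only at h; omega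
  have io : Function.Injective (fun l : ℤ => 2 * l - 1) := fun a b h => by
    simp only at h; omega
  have hE' : HasSum (F ∘ fun l : ℤ => 2 * l) (x * (Real.cosh x / Real.sinh x)) := by
    convert hE using 2 with l
    simp only [hFdef, Function.comp]
    push_cast
    rw [show (2 * (l : ℝ)) ^ 2 * Real.pi ^ 2 + (2 * x) ^ 2 =
      4 * ((l : ℝ) ^ 2 * Real.pi ^ 2 + x ^ 2) by ring, show (2 * x) ^ 2 = 4 * x ^ 2 by ring,
      mul_div_mul_left _ _ (by norm_num)]
  have hO := (hF.summable.comp_injective io).hasSum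
  have hc : IsCompl (Set.range fun l : ℤ => 2 * l) (Set.range fun l : ℤ => 2 * l - 1) := by
    rw [← compl_eq_iff_isCompl]
    ext n
    simp only [Set.mem_compl_iff, Set.mem_range, not_exists]
    constructor
    · intro h
      have := h (n / 2)
      exact ⟨(n + 1) / 2, by omega⟩
    · rintro ⟨l, rfl⟩ m; omega
  have hsum := HasSum.add_isCompl (f := F) hc (ie.hasSum_range_iff.mpr hE') (io.hasSum_range_iff.mpr hO)
  have heq := hsum.unique hF
  have hs : Real.sinh x ≠ 0 := by simpa [Real.sinh_eq_zero] using hx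
  have hch : Real.cosh x ≠ 0 := (Real.cosh_pos x).ne'
  have hval : (∑' l, (F ∘ fun l : ℤ => 2 * l - 1) l) = x * Real.tanh x := by
    rw [eq_sub_of_add_eq' heq, Real.cosh_two_mul, Real.sinh_two_mul, Real.tanh_eq_sinh_div_cosh]
    field_simp
    ring
  rw [hval] at hO
  have hfun : (fun l : ℤ => 4 * x ^ 2 / ((2 * (l : ℝ) - 1) ^ 2 * Real.pi ^ 2 + 4 * x ^ 2)) =
      F ∘ fun l : ℤ => 2 * l - 1 := by
    funext l
    simp only [hFdef, Function.comp]
    push_cast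
    rw [show (2 * x) ^ 2 = 4 * x ^ 2 by ring]
  rw [hfun]
  exact hO
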